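/- The Melnikov potential L(u,θ) = -∫_{-∞}^{∞} ½ q_h(u+t)⁴ V(θ + νI₀ t) dt has Fourier coefficients (in the variable θ - νI₀u) given by L^[k](νI₀) = -(π νI₀ V^[k]/4) e^{-|k|νI₀}(|k| + 1/(νI₀)) for every k ∈ ℤ; in particular L^[0] = 0 when V^[0] = 0. -/

import Mathlib

open MeasureTheory

open Set Filter Topology FourierTransform

lemma integrableOn_Ioi_one_add_mul_exp_neg_mul {b : ℝ} (hb : 0 < b) :
    IntegrableOn (fun x : ℝ => (1 + x) * Real.exp (-b * x)) (Ioi 0) := by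
  have h₀ := integrableOn_rpow_mul_exp_neg_mul_rpow (s := 0) (p := 1) (by norm_num) one_pos hb
  have h₁ := integrableOn_rpow_mul_exp_neg_mul_rpow (s := 1) (p := 1) (by norm_num) one_pos hb
  refine (h₀.add h₁).congr_fun (fun x _ => ?_) measurableSet_Ioi
  simp only [Pi.add_apply, Real.rpow_zero, Real.rpow_one]
  ring

lemma integrableOn_Ioi_one_add_mul_cexp_neg_mul {z : ℂ} (hz : 0 < z.re) :
    IntegrableOn (fun x : ℝ => (1 + (x : ℂ)) * Complex.exp (-z * x)) (Ioi 0) := by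
  refine (integrableOn_Ioi_one_add_mul_exp_neg_mul hz).mono'
    (Continuous.aestronglyMeasurable (by fun_prop)) ?_
  filter_upwards [ae_restrict_mem measurableSet_Ioi] with x hx
  have hx' : 0 < 1 + x := by linarith [mem_Ioi.1 hx]
  rw [norm_mul, Complex.norm_exp, show (1 + (x : ℂ)) = ((1 + x : ℝ) : ℂ) by push_cast; rfl,
    Complex.norm_of_nonneg hx'.le]
  simp

lemma integral_Ioi_one_add_mul_cexp_neg_mul {z : ℂ} (hz : 0 < z.re) :
    ∫ x : ℝ in Ioi 0, (1 + (x : ℂ)) * Complex.exp (-z * x) = 1 / z + 1 / z ^ 2 := by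
  have hz₀ : z ≠ 0 := by rintro rfl; simp at hz
  let F : ℝ → ℂ := fun x => -(1 / z + 1 / z ^ 2 + x / z) * Complex.exp (-z * x)
  have hF (x : ℝ) : HasDerivAt F ((1 + (x : ℂ)) * Complex.exp (-z * x)) x := by
    have h₁ : HasDerivAt (fun x : ℝ => (x : ℂ)) 1 x := Complex.ofRealCLM.hasDerivAt
    have h₂ := ((h₁.div_const z).const_add (1 / z + 1 / z ^ 2)).neg.mul (h₁.const_mul (-z)).cexp
    refine h₂.congr_deriv ?_
    simp only [Pi.neg_apply]
    field_simp
    ring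
  have hlim (s : ℝ) :
      Tendsto (fun x : ℝ => ((x ^ s : ℝ) : ℂ) * Complex.exp (-z * x)) atTop (𝓝 0) := by
    rw [tendsto_zero_iff_norm_tendsto_zero]
    refine (tendsto_rpow_mul_exp_neg_mul_atTop_nhds_zero s z.re hz).congr' ?_
    filter_upwards [eventually_ge_atTop 0] with x hx
    rw [norm_mul, Complex.norm_exp, Complex.norm_of_nonneg (Real.rpow_nonneg hx s)]
    simp
  have hF' : Tendsto F atTop (𝓝 0) := by
    have h := ((hlim 0).const_mul (-(1 / z + 1 / z ^ 2))).add ((hlim 1).const_mul (-(1 / z)))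
    simp only [mul_zero, add_zero] at h
    refine h.congr fun x => ?_
    simp only [Real.rpow_zero, Real.rpow_one, F, Complex.ofReal_one]
    ring
  rw [integral_Ioi_of_hasDerivAt_of_tendsto (hF 0).continuousAt.continuousWithinAt
    (fun x _ => hF x) (integrableOn_Ioi_one_add_mul_cexp_neg_mul hz) hF']
  simp [F]

/-- The function `(1 + |x|) e^{-|x|}`, whose Fourier transform is `4 / (1 + (2πw)²)²`. -/
noncomputable def oneAddAbsMulExpNegAbs (x : ℝ) : ℂ :=
  (1 + ((|x| : ℝ) : ℂ)) * (Real.exp (-|x|) : ℂ)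

lemma continuous_oneAddAbsMulExpNegAbs : Continuous oneAddAbsMulExpNegAbs := by
  unfold oneAddAbsMulExpNegAbs
  fun_prop

lemma cexp_mul_oneAddAbsMulExpNegAbs (y : ℝ) {x : ℝ} (hx : 0 < x) :
    Complex.exp (-(y * x) * Complex.I) * oneAddAbsMulExpNegAbs x =
      (1 + (x : ℂ)) * Complex.exp (-(1 + y * Complex.I) * x) := by
  rw [oneAddAbsMulExpNegAbs, abs_of_pos hx, Complex.ofReal_exp, mul_left_comm, ← Complex.exp_add]
  push_cast
  ring_nf

lemma oneAddAbsMulExpNegAbs_neg (x : ℝ) :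
    oneAddAbsMulExpNegAbs (-x) = oneAddAbsMulExpNegAbs x := by
  simp [oneAddAbsMulExpNegAbs]

lemma integrableOn_Ioi_cexp_mul_oneAddAbsMulExpNegAbs (y : ℝ) :
    IntegrableOn (fun x : ℝ => Complex.exp (-(y * x) * Complex.I) * oneAddAbsMulExpNegAbs x)
      (Ioi 0) :=
  (integrableOn_Ioi_one_add_mul_cexp_neg_mul (z := 1 + y * Complex.I) (by simp)).congr_fun
    (fun _ hx => (cexp_mul_oneAddAbsMulExpNegAbs y hx).symm) measurableSet_Ioi

lemma integrableOn_Iic_cexp_mul_oneAddAbsMulExpNegAbs (y : ℝ) :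
    IntegrableOn (fun x : ℝ => Complex.exp (-(y * x) * Complex.I) * oneAddAbsMulExpNegAbs x)
      (Iic 0) := by
  rw [integrableOn_Iic_iff_integrableOn_Iio]
  have h := integrableOn_Ioi_cexp_mul_oneAddAbsMulExpNegAbs (-y)
  rw [← neg_zero] at h
  simpa [oneAddAbsMulExpNegAbs_neg] using h.comp_neg_Iio

lemma integrable_oneAddAbsMulExpNegAbs : Integrable oneAddAbsMulExpNegAbs := by
  rw [← integrableOn_univ, ← Iic_union_Ioi (a := (0 : ℝ))]
  simpa using (integrableOn_Iic_cexp_mul_oneAddAbsMulExpNegAbs 0).union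
    (integrableOn_Ioi_cexp_mul_oneAddAbsMulExpNegAbs 0)

lemma one_add_sq_ne_zero (y : ℝ) : (1 : ℂ) + (y : ℂ) ^ 2 ≠ 0 := by
  exact_mod_cast (by positivity : (1 + y ^ 2 : ℝ) ≠ 0)

lemma integral_cexp_mul_oneAddAbsMulExpNegAbs (y : ℝ) :
    ∫ x : ℝ, Complex.exp (-(y * x) * Complex.I) * oneAddAbsMulExpNegAbs x =
      4 / (1 + (y : ℂ) ^ 2) ^ 2 := by
  have hIoi (y : ℝ) :
      ∫ x : ℝ in Ioi 0, Complex.exp (-(y * x) * Complex.I) * oneAddAbsMulExpNegAbs x =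
        1 / (1 + y * Complex.I) + 1 / (1 + y * Complex.I) ^ 2 := by
    rw [← integral_Ioi_one_add_mul_cexp_neg_mul (by simp)]
    exact setIntegral_congr_fun measurableSet_Ioi
      fun x hx => cexp_mul_oneAddAbsMulExpNegAbs y hx
  have hIic :
      ∫ x : ℝ in Iic 0, Complex.exp (-(y * x) * Complex.I) * oneAddAbsMulExpNegAbs x =
        ∫ x : ℝ in Ioi 0, Complex.exp (-((-y : ℝ) * x) * Complex.I) * oneAddAbsMulExpNegAbs x := by
    rw [← neg_zero, ← integral_comp_neg_Ioi, neg_zero]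
    simp [oneAddAbsMulExpNegAbs_neg]
  rw [← intervalIntegral.integral_Iic_add_Ioi (integrableOn_Iic_cexp_mul_oneAddAbsMulExpNegAbs y)
    (integrableOn_Ioi_cexp_mul_oneAddAbsMulExpNegAbs y), hIic, hIoi, hIoi]
  have h : (1 + y * Complex.I) * (1 - y * Complex.I) = 1 + (y : ℂ) ^ 2 := by
    linear_combination -(y : ℂ) ^ 2 * Complex.I_sq
  have h₀ := one_add_sq_ne_zero y
  have h₁ : 1 + y * Complex.I ≠ 0 := left_ne_zero_of_mul (h ▸ h₀)
  have h₂ : 1 - y * Complex.I ≠ 0 := right_ne_zero_of_mul (h ▸ h₀)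
  rw [← h, Complex.ofReal_neg, neg_mul, ← sub_eq_add_neg]
  field_simp
  linear_combination (2 : ℂ) * y ^ 2 * Complex.I_sq + 2 * h

lemma fourier_oneAddAbsMulExpNegAbs (w : ℝ) :
    𝓕 oneAddAbsMulExpNegAbs w = 4 / (1 + ((2 * Real.pi * w : ℝ) : ℂ) ^ 2) ^ 2 := by
  rw [Real.fourier_real_eq_integral_exp_smul, ← integral_cexp_mul_oneAddAbsMulExpNegAbs]
  congr 1 with x
  rw [smul_eq_mul]
  push_cast
  ring_nf

lemma integrable_four_div_one_add_sq_sq :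
    Integrable fun t : ℝ => 4 / ((1 : ℂ) + (t : ℂ) ^ 2) ^ 2 := by
  refine (integrable_inv_one_add_sq.const_mul 4).mono'
    (Continuous.aestronglyMeasurable ?_) (.of_forall fun t => ?_)
  · exact continuous_const.div (by fun_prop) fun t => pow_ne_zero 2 (one_add_sq_ne_zero t)
  · have h : (1 : ℝ) ≤ 1 + t ^ 2 := by nlinarith [sq_nonneg t]
    rw [show 4 / ((1 : ℂ) + (t : ℂ) ^ 2) ^ 2 = ((4 / (1 + t ^ 2) ^ 2 : ℝ) : ℂ) by push_cast; rfl,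
      Complex.norm_of_nonneg (by positivity), div_eq_mul_inv]
    gcongr
    nlinarith

lemma integral_inv_one_add_sq_sq_mul_cexp (a : ℝ) :
    ∫ t : ℝ, (1 / ((1 : ℂ) + (t : ℂ) ^ 2) ^ 2) * Complex.exp (a * t * Complex.I) =
      Real.pi / 2 * oneAddAbsMulExpNegAbs a := by
  have hint : Integrable (𝓕 oneAddAbsMulExpNegAbs) := by
    rw [funext fourier_oneAddAbsMulExpNegAbs]
    exact integrable_four_div_one_add_sq_sq.comp_mul_left' Real.two_pi_pos.ne'
  have hinv := integrable_oneAddAbsMulExpNegAbs.fourierInv_fourier_eq hint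
    (v := a) continuous_oneAddAbsMulExpNegAbs.continuousAt
  rw [Real.fourierInv_eq_fourier_neg, Real.fourier_real_eq_integral_exp_smul] at hinv
  have hscale := Measure.integral_comp_mul_left
    (fun t : ℝ => (1 / ((1 : ℂ) + (t : ℂ) ^ 2) ^ 2) * Complex.exp (a * t * Complex.I))
    (2 * Real.pi)
  have hcongr : oneAddAbsMulExpNegAbs a =
      4 * ∫ w : ℝ, (1 / ((1 : ℂ) + ((2 * Real.pi * w : ℝ) : ℂ) ^ 2) ^ 2) *
        Complex.exp (a * (2 * Real.pi * w : ℝ) * Complex.I) := by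
    rw [← hinv, ← integral_const_mul]
    congr 1 with w
    rw [fourier_oneAddAbsMulExpNegAbs, smul_eq_mul]
    push_cast
    ring_nf
  have hpi : (Real.pi : ℂ) ≠ 0 := by exact_mod_cast Real.pi_ne_zero
  rw [hcongr, hscale, abs_of_pos (by positivity), Complex.real_smul]
  generalize ∫ t : ℝ, (1 / ((1 : ℂ) + (t : ℂ) ^ 2) ^ 2) * Complex.exp (a * t * Complex.I) = J
  push_cast
  field_simp
  ring

/-- The `k`-th Fourier coefficient of the Melnikov potential:
`L^[k](ω) = -(c/2)∫ q_h(t)⁴ e^{ikωt} dt = -(πωc/4) e^{-|k|ω}(|k| + 1/ω)`,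
where `c = V^[k]`; in particular it vanishes when `c = 0`. -/
theorem stmt_4 (ω : ℝ) (hω : 0 < ω) (k : ℤ) (c : ℂ) :
    (-(c / 2) * ∫ t : ℝ, (1 / ((1 : ℂ) + (t : ℂ) ^ 2) ^ 2) *
        Complex.exp (Complex.I * k * ω * t)
      = -((Real.pi : ℂ) * (ω : ℂ) * c / 4) * (Real.exp (-((|k| : ℝ) * ω)) : ℂ) *
          (((|k| : ℝ) : ℂ) + 1 / (ω : ℂ))) ∧
    (c = 0 →
      -(c / 2) * ∫ t : ℝ, (1 / ((1 : ℂ) + (t : ℂ) ^ 2) ^ 2) *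
          Complex.exp (Complex.I * k * ω * t) = 0) := by
  refine ⟨?_, fun hc => by simp [hc]⟩
  have harg (t : ℝ) : Complex.I * k * ω * t = ((k * ω : ℝ) : ℂ) * t * Complex.I := by
    push_cast
    ring
  simp_rw [harg]
  rw [integral_inv_one_add_sq_sq_mul_cexp, oneAddAbsMulExpNegAbs, abs_mul, abs_of_pos hω]
  have hω₀ : (ω : ℂ) ≠ 0 := by exact_mod_cast hω.ne'
  push_cast
  field_simp
  ring
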